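/- Let S be a set of primes having natural density d(S), and define the error function E(x) := π_S(x)/π(x) − d(S) for x ≥ 2. If there exist constants α > 0, C > 0 and B > 0 such that |E(x)| ≤ C / (log x)^α for all x > B, then S is a weakly regular set of primes having Dirichlet density δ(S) = d(S). -/

import Mathlib

open Filter Topology

/-- `primeCount S x = #{p ∈ S : p ≤ x}`, the counting function of a set `S ⊆ ℕ`. -/
noncomputable def primeCount (S : Set ℕ) (x : ℝ) : ℕ := {p ∈ S | (p : ℝ) ≤ x}.ncard

theorem exists_continuousOn_closure_eqOn_of_exp_eq {F G : ℂ → ℂ} {U : Set ℂ} (hUo : IsOpen U)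
    (hUc : Convex ℝ U) (hF : Differentiable ℂ F) (hF0 : ∀ z ∈ closure U, F z ≠ 0)
    (hG : DifferentiableOn ℂ G U) (hGF : ∀ z ∈ U, Complex.exp (G z) = F z) :
    ∃ h : ℂ → ℂ, ContinuousOn h (closure U) ∧ Set.EqOn h G U := by
  refine ⟨extendFrom U G, continuousOn_extendFrom subset_rfl fun w hw ↦ ?_, fun z hz ↦ ?_⟩
  swap
  · exact extendFrom_eq (subset_closure hz) (hG.continuousOn z hz)
  have hw0 := hF0 w hw
  have hFw : Differentiable ℂ fun z ↦ F z / F w := hF.div_const _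
  have hnhds : ∀ᶠ z in 𝓝 w, F z / F w ∈ Complex.slitPlane :=
    hFw.continuous.continuousAt.eventually_mem
      (Complex.isOpen_slitPlane.mem_nhds (by simp [div_self hw0]))
  obtain ⟨r, hr, hball⟩ := Metric.eventually_nhds_iff_ball.1 hnhds
  set V := U ∩ Metric.ball w r with hV
  have hVo : IsOpen V := hUo.inter Metric.isOpen_ball
  have hVc : Convex ℝ V := hUc.inter (convex_ball w r)
  set H : ℂ → ℂ := fun z ↦ G z - Complex.log (F z / F w) with hH
  have hHd : DifferentiableOn ℂ H V := (hG.mono Set.inter_subset_left).sub fun z hz ↦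
    ((hFw z).clog (hball z hz.2)).differentiableWithinAt
  have hHexp : ∀ z ∈ V, Complex.exp (H z) = F w := fun z hz ↦ by
    have hz0 := hF0 z (subset_closure hz.1)
    rw [hH, Complex.exp_sub, hGF z hz.1, Complex.exp_log (div_ne_zero hz0 hw0)]
    field_simp
  have hHderiv : V.EqOn (deriv H) 0 := fun z hz ↦ by
    have h1 := ((hHd z hz).differentiableAt (hVo.mem_nhds hz)).hasDerivAt.cexp
    have h2 : (fun z ↦ Complex.exp (H z)) =ᶠ[𝓝 z] fun _ ↦ F w :=
      eventually_of_mem (hVo.mem_nhds hz) hHexp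
    have h3 := h1.unique ((hasDerivAt_const z (F w)).congr_of_eventuallyEq h2)
    simpa [Complex.exp_ne_zero] using h3
  obtain ⟨a, ha⟩ := hVo.exists_is_const_of_deriv_eq_zero hVc.isPreconnected hHd hHderiv
  refine ⟨a + Complex.log (F w / F w), ?_⟩
  have hlim : Tendsto (fun z ↦ a + Complex.log (F z / F w)) (𝓝[U] w)
      (𝓝 (a + Complex.log (F w / F w))) :=
    (((hFw.continuous.continuousAt (x := w)).clog (by simp [div_self hw0])).const_add
      a).continuousWithinAt
  refine hlim.congr' ?_
  filter_upwards [self_mem_nhdsWithin, mem_nhdsWithin_of_mem_nhds (Metric.ball_mem_nhds w hr)]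
    with z hz hz'
  rw [← ha z ⟨hz, hz'⟩, hH, sub_add_cancel]

theorem differentiable_update_sub_one_mul_riemannZeta :
    Differentiable ℂ (Function.update (fun s ↦ (s - 1) * riemannZeta s) 1 1) := by
  have hne : ∀ s : ℂ, s ≠ 1 →
      DifferentiableAt ℂ (Function.update (fun s ↦ (s - 1) * riemannZeta s) 1 1) s := fun s hs ↦ by
    refine DifferentiableAt.congr_of_eventuallyEq (f := fun s ↦ (s - 1) * riemannZeta s)
      (by have := differentiableAt_riemannZeta hs; fun_prop) ?_
    filter_upwards [eventually_ne_nhds hs] with z hz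
    rw [Function.update_of_ne hz]
  intro s
  rcases eq_or_ne s 1 with rfl | hs
  · refine (Complex.analyticAt_of_differentiable_on_punctured_nhds_of_continuousAt
      (eventually_nhdsWithin_of_forall hne) ?_).differentiableAt
    rw [continuousAt_update_same]
    exact riemannZeta_residue_one
  · exact hne s hs

theorem closure_one_lt_re : closure {z : ℂ | 1 < z.re} = {z : ℂ | 1 ≤ z.re} :=
  Complex.closure_setOfPred_lt_re 1

theorem norm_prime_cpow_neg_le (p : Nat.Primes) {z : ℂ} (hz : 1 ≤ z.re) :
    ‖((p : ℕ) : ℂ) ^ (-z)‖ ≤ ((p : ℕ) : ℝ)⁻¹ := by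
  rw [Complex.norm_natCast_cpow_of_pos p.2.pos, ← Real.rpow_neg_one]
  exact Real.rpow_le_rpow_of_exponent_le (by exact_mod_cast p.2.one_le) (by simpa using hz)

theorem norm_neg_log_one_sub_prime_cpow_sub_le (p : Nat.Primes) {z : ℂ} (hz : 1 ≤ z.re) :
    ‖-Complex.log (1 - ((p : ℕ) : ℂ) ^ (-z)) - ((p : ℕ) : ℂ) ^ (-z)‖ ≤ ((p : ℕ) : ℝ) ^ (-2 : ℝ) := by
  set w := ((p : ℕ) : ℂ) ^ (-z)
  have hw : ‖w‖ ≤ ((p : ℕ) : ℝ)⁻¹ := norm_prime_cpow_neg_le p hz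
  have hp : ((p : ℕ) : ℝ)⁻¹ ≤ 2⁻¹ := inv_anti₀ two_pos (by exact_mod_cast p.2.two_le)
  have h := Complex.norm_log_one_add_sub_self_le (z := -w) (by rw [norm_neg]; linarith)
  have h2 : (1 - ‖w‖)⁻¹ ≤ 2 := by
    rw [inv_le_comm₀ (by linarith) two_pos]; linarith
  have h3 : -Complex.log (1 - w) - w = -(Complex.log (1 + -w) - -w) := by ring_nf
  rw [h3, norm_neg]
  rw [norm_neg] at h
  calc _ ≤ ‖w‖ ^ 2 * (1 - ‖w‖)⁻¹ / 2 := h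
    _ ≤ ‖w‖ ^ 2 * 2 / 2 := by gcongr
    _ = ‖w‖ ^ 2 := by ring
    _ ≤ (((p : ℕ) : ℝ)⁻¹) ^ 2 := by gcongr
    _ = _ := by rw [Real.rpow_neg (by positivity), inv_pow]; norm_cast

theorem differentiableAt_neg_log_one_sub_prime_cpow_sub (p : Nat.Primes) {z : ℂ} (hz : 1 ≤ z.re) :
    DifferentiableAt ℂ
      (fun z ↦ -Complex.log (1 - ((p : ℕ) : ℂ) ^ (-z)) - ((p : ℕ) : ℂ) ^ (-z)) z := by
  have hp : ((p : ℕ) : ℂ) ≠ 0 := by exact_mod_cast p.2.ne_zero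
  have hd : DifferentiableAt ℂ (fun z : ℂ ↦ ((p : ℕ) : ℂ) ^ (-z)) z :=
    differentiableAt_id.neg.const_cpow (Or.inl hp)
  refine (((hd.const_sub 1).clog ?_).neg).sub hd
  rw [sub_eq_add_neg]
  refine Complex.mem_slitPlane_of_norm_lt_one ?_
  rw [norm_neg]
  refine (norm_prime_cpow_neg_le p hz).trans_lt (inv_lt_one_of_one_lt₀ ?_)
  exact_mod_cast p.2.one_lt

theorem summable_prime_cpow_neg {z : ℂ} (hz : 1 < z.re) :
    Summable fun p : Nat.Primes ↦ ((p : ℕ) : ℂ) ^ (-z) := by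
  refine Summable.of_norm ?_
  simp_rw [fun p : Nat.Primes ↦ Complex.norm_natCast_cpow_of_pos p.2.pos (-z)]
  exact Nat.Primes.summable_rpow.2 (by simpa using hz)

theorem tsum_subtype_cpow_neg_eq_LSeries {S : Set ℕ} (hS : ∀ p ∈ S, Nat.Prime p) (z : ℂ) :
    ∑' p : S, ((p : ℕ) : ℂ) ^ (-z) = LSeries (S.indicator 1) z := by
  rw [tsum_subtype S fun n : ℕ ↦ (n : ℂ) ^ (-z), LSeries]
  refine tsum_congr fun n ↦ ?_
  by_cases hn : n ∈ S
  · simp [hn, (hS n hn).ne_zero, Complex.cpow_neg]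
  · simp [hn, LSeries.term_def]

theorem norm_indicator_one_le (S : Set ℕ) (n : ℕ) : ‖S.indicator (1 : ℕ → ℂ) n‖ ≤ 1 :=
  (norm_indicator_le_norm_self _ _).trans (by simp)

theorem differentiableOn_LSeries_indicator (S : Set ℕ) :
    DifferentiableOn ℂ (LSeries (S.indicator 1)) {z : ℂ | 1 < z.re} :=
  (LSeries_differentiableOn _).mono fun z hz ↦
    (LSeries.abscissaOfAbsConv_le_of_le_const ⟨1, fun n _ ↦ norm_indicator_one_le S n⟩).trans_lt
      (by exact_mod_cast hz)

theorem exists_continuousOn_tsum_primes_eq_log_add :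
    ∃ h : ℂ → ℂ, ContinuousOn h {z : ℂ | 1 ≤ z.re} ∧ ∀ z : ℂ, 1 < z.re →
      LSeries ({p | Nat.Prime p}.indicator 1) z = Complex.log (1 / (z - 1)) + h z := by
  set Q : ℂ → ℂ := fun z ↦ ∑' p : Nat.Primes,
    (-Complex.log (1 - ((p : ℕ) : ℂ) ^ (-z)) - ((p : ℕ) : ℂ) ^ (-z)) with hQ
  have hsum : Summable fun p : Nat.Primes ↦ ((p : ℕ) : ℝ) ^ (-2 : ℝ) :=
    Nat.Primes.summable_rpow.2 (by norm_num)
  have hUo : IsOpen {z : ℂ | 1 < z.re} := isOpen_lt continuous_const Complex.continuous_re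
  have hQc : ContinuousOn Q {z : ℂ | 1 ≤ z.re} := continuousOn_tsum (fun p z hz ↦
    (differentiableAt_neg_log_one_sub_prime_cpow_sub p hz).continuousAt.continuousWithinAt) hsum
    fun p z hz ↦ norm_neg_log_one_sub_prime_cpow_sub_le p hz
  have hQd : DifferentiableOn ℂ Q {z : ℂ | 1 < z.re} :=
    Complex.differentiableOn_tsum_of_summable_norm hsum (fun p z hz ↦
      (differentiableAt_neg_log_one_sub_prime_cpow_sub p
        (le_of_lt hz)).differentiableWithinAt) hUo
      fun p z hz ↦ norm_neg_log_one_sub_prime_cpow_sub_le p (le_of_lt hz)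
  set P : ℂ → ℂ := LSeries ({p | Nat.Prime p}.indicator 1) with hP
  have hPd : DifferentiableOn ℂ P {z : ℂ | 1 < z.re} := differentiableOn_LSeries_indicator _
  have hslit : ∀ z : ℂ, 1 < z.re → z - 1 ∈ Complex.slitPlane := fun z hz ↦ Or.inl (by simpa using hz)
  have hexp : ∀ z ∈ {z : ℂ | 1 < z.re}, Complex.exp (P z + Q z + Complex.log (z - 1)) =
      Function.update (fun s ↦ (s - 1) * riemannZeta s) 1 1 z := fun z (hz : 1 < z.re) ↦ by
    have hz1 : z ≠ 1 := fun h ↦ by simp [h] at hz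
    have hPQ : P z + Q z = ∑' p : Nat.Primes, -Complex.log (1 - ((p : ℕ) : ℂ) ^ (-z)) := by
      have hs1 := summable_prime_cpow_neg hz
      have hs2 : Summable fun p : Nat.Primes ↦
          (-Complex.log (1 - ((p : ℕ) : ℂ) ^ (-z)) - ((p : ℕ) : ℂ) ^ (-z)) :=
        Summable.of_norm_bounded hsum fun p ↦ norm_neg_log_one_sub_prime_cpow_sub_le p hz.le
      have hPz : P z = ∑' p : Nat.Primes, ((p : ℕ) : ℂ) ^ (-z) :=
        (tsum_subtype_cpow_neg_eq_LSeries (fun p hp ↦ hp) z).symm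
      rw [hPz, hQ, ← hs1.tsum_add hs2]
      simp
    rw [Function.update_of_ne hz1, Complex.exp_add, hPQ, riemannZeta_eulerProduct_exp_log hz,
      Complex.exp_log (sub_ne_zero.2 hz1), mul_comm]
  obtain ⟨h, hc, heq⟩ := exists_continuousOn_closure_eqOn_of_exp_eq hUo
    (convex_halfSpace_re_gt 1) differentiable_update_sub_one_mul_riemannZeta (fun z hz ↦ by
      rw [closure_one_lt_re] at hz
      rcases eq_or_ne z 1 with rfl | hz1
      · simp
      · rw [Function.update_of_ne hz1]
        exact mul_ne_zero (sub_ne_zero.2 hz1) (riemannZeta_ne_zero_of_one_le_re hz))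
    ((hPd.add hQd).add fun z hz ↦
      ((differentiableAt_id.sub_const 1).clog (hslit z hz)).differentiableWithinAt) hexp
  rw [closure_one_lt_re] at hc
  refine ⟨fun z ↦ h z - Q z, hc.sub hQc, fun z hz ↦ ?_⟩
  have := heq (show z ∈ {z : ℂ | 1 < z.re} from hz)
  rw [one_div, Complex.log_inv _ (Complex.slitPlane_arg_ne_pi (hslit z hz))]
  simp only [this, id, Pi.add_apply]
  ring

theorem integrableOn_Ioi_inv_mul_log_rpow {α : ℝ} (hα : 0 < α) :
    MeasureTheory.IntegrableOn (fun t : ℝ ↦ t⁻¹ * Real.log t ^ (-α - 1)) (Set.Ioi 2) := by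
  refine MeasureTheory.integrableOn_Ioi_deriv_of_nonneg'
    (g := fun t ↦ -α⁻¹ * Real.log t ^ (-α)) (l := -α⁻¹ * 0) (fun t ht ↦ ?_) (fun t ht ↦ ?_) ?_
  · have ht2 : (2 : ℝ) ≤ t := ht
    have hlog : 0 < Real.log t := Real.log_pos (by linarith)
    convert! (((Real.hasDerivAt_log (by linarith : t ≠ 0)).rpow_const
      (p := -α) (Or.inl hlog.ne')).const_mul (-α⁻¹)) using 1
    field_simp
  · have ht2 : (2 : ℝ) < t := ht
    have hlog : 0 < Real.log t := Real.log_pos (by linarith)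
    positivity
  · exact ((tendsto_rpow_neg_atTop hα).comp Real.tendsto_log_atTop).const_mul _

theorem exists_continuousOn_eq_LSeries_of_isBigO {f : ℕ → ℂ} {K α : ℝ} (hf : ∀ n, ‖f n‖ ≤ K)
    (hα : 0 < α) (hO : (fun t : ℝ ↦ ∑ k ∈ Finset.Icc 1 ⌊t⌋₊, f k) =O[atTop]
      fun t ↦ t * Real.log t ^ (-α - 1)) :
    ∃ h : ℂ → ℂ, ContinuousOn h {z : ℂ | 1 ≤ z.re} ∧ ∀ z : ℂ, 1 < z.re → LSeries f z = h z := by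
  refine ⟨fun z ↦ z * ∫ t in Set.Ioi (1 : ℝ), (∑ k ∈ Finset.Icc 1 ⌊t⌋₊, f k) * (t : ℂ) ^ (-(z + 1)),
    continuousOn_id.mul ?_, fun z hz ↦ LSeries_eq_mul_integral' f zero_le_one hz ?_⟩
  swap
  · refine Asymptotics.isBigO_of_le' (c := K) _ fun n ↦ ?_
    rw [Real.norm_of_nonneg (Finset.sum_nonneg fun _ _ ↦ norm_nonneg _), Real.rpow_one,
      Real.norm_of_nonneg n.cast_nonneg]
    refine (Finset.sum_le_card_nsmul _ _ K fun k _ ↦ hf k).trans ?_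
    simp [mul_comm]
  have hmeas : Measurable fun t : ℝ ↦ ∑ k ∈ Finset.Icc 1 ⌊t⌋₊, f k :=
    (measurable_from_nat (f := fun n ↦ ∑ k ∈ Finset.Icc 1 n, f k)).comp Nat.measurable_floor
  have hloc : MeasureTheory.LocallyIntegrableOn
      (fun t : ℝ ↦ ((t ^ (-2 : ℝ) : ℝ) : ℂ) * ∑ k ∈ Finset.Icc 1 ⌊t⌋₊, f k) (Set.Ici 1) := by
    refine locallyIntegrableOn_mul_sum_Icc f zero_le_one ?_
    refine ContinuousOn.locallyIntegrableOn ?_ measurableSet_Ici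
    refine Complex.continuous_ofReal.comp_continuousOn ?_
    exact continuousOn_id.rpow_const fun t ht ↦ Or.inl (zero_lt_one.trans_le ht).ne'
  have hint : MeasureTheory.IntegrableOn
      (fun t : ℝ ↦ ((t ^ (-2 : ℝ) : ℝ) : ℂ) * ∑ k ∈ Finset.Icc 1 ⌊t⌋₊, f k) (Set.Ici 1) := by
    refine hloc.integrableOn_of_isBigO_atTop (g := fun t : ℝ ↦ t⁻¹ * Real.log t ^ (-α - 1)) ?_
      ⟨Set.Ioi 2, Ioi_mem_atTop 2, integrableOn_Ioi_inv_mul_log_rpow hα⟩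
    refine (Asymptotics.IsBigO.mul (Asymptotics.isBigO_of_le (g := fun t : ℝ ↦ t ^ (-2 : ℝ)) _
      fun t ↦ (Complex.norm_real _).le) hO).congr' EventuallyEq.rfl ?_
    filter_upwards [eventually_gt_atTop 0] with t ht
    rw [← mul_assoc, ← Real.rpow_add_one ht.ne', ← Real.rpow_neg_one]
    norm_num
  refine MeasureTheory.continuousOn_of_dominated (fun z hz ↦ ?_) (fun z hz ↦ ?_)
    (hint.mono_set Set.Ioi_subset_Ici_self).norm ?_
  · exact (hmeas.mul (by fun_prop)).aestronglyMeasurable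
  · refine MeasureTheory.ae_restrict_of_forall_mem measurableSet_Ioi fun t ht ↦ ?_
    have ht1 : (1 : ℝ) < t := ht
    have hz1 : 1 ≤ z.re := hz
    have ht0 : 0 < t := by linarith
    rw [norm_mul, norm_mul, mul_comm, Complex.norm_cpow_eq_rpow_re_of_pos ht0, Complex.norm_real,
      Real.norm_of_nonneg (by positivity)]
    refine mul_le_mul_of_nonneg_right ?_ (norm_nonneg _)
    refine Real.rpow_le_rpow_of_exponent_le ht1.le ?_
    simp only [Complex.neg_re, Complex.add_re, Complex.one_re]
    linarith
  · refine MeasureTheory.ae_restrict_of_forall_mem measurableSet_Ioi fun t ht ↦ ?_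
    have ht0 : (t : ℂ) ≠ 0 := by exact_mod_cast (zero_lt_one.trans ht).ne'
    exact (continuous_const.mul
      ((continuous_id.add continuous_const).neg.const_cpow (Or.inl ht0))).continuousOn

theorem primeCount_eq_sum_indicator {S : Set ℕ} (hS : 0 ∉ S) {x : ℝ} (hx : 0 ≤ x) :
    (primeCount S x : ℂ) = ∑ k ∈ Finset.Icc 1 ⌊x⌋₊, S.indicator 1 k := by
  classical
  have h : {p ∈ S | (p : ℝ) ≤ x} = ↑((Finset.Icc 1 ⌊x⌋₊).filter (· ∈ S)) := by
    ext p
    have : p ∈ S → 1 ≤ p := fun hp ↦ Nat.one_le_iff_ne_zero.2 fun h0 ↦ hS (h0 ▸ hp)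
    simp only [Set.mem_ofPred_eq, Finset.coe_filter, Finset.mem_Icc, Nat.le_floor_iff hx]
    tauto
  rw [primeCount, h, Set.ncard_coe_finset, Finset.card_filter]
  push_cast
  simp [Set.indicator_apply]

theorem primeCount_setOf_prime {x : ℝ} (hx : 0 ≤ x) :
    primeCount {p | Nat.Prime p} x = Nat.primeCounting ⌊x⌋₊ := by
  have h : {p ∈ {p | Nat.Prime p} | (p : ℝ) ≤ x} =
      ↑((Finset.range (⌊x⌋₊ + 1)).filter Nat.Prime) := by
    ext p
    simp only [Set.mem_ofPred_eq, Finset.coe_filter, Finset.mem_range, Nat.lt_succ_iff,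
      Nat.le_floor_iff hx]
    tauto
  rw [primeCount, h, Set.ncard_coe_finset, Nat.primeCounting, Nat.primeCounting',
    Nat.count_eq_card_filter_range]

theorem isBigO_sum_indicator_sub_of_log_power_error {S : Set ℕ} (hS : ∀ p ∈ S, Nat.Prime p)
    {d α C B : ℝ} (hE : ∀ x : ℝ, B < x →
      |(primeCount S x : ℝ) / (primeCount {p | Nat.Prime p} x : ℝ) - d| ≤
        C / Real.log x ^ α) :
    (fun t : ℝ ↦ ∑ k ∈ Finset.Icc 1 ⌊t⌋₊,
      (S.indicator 1 - (d : ℂ) • {p | Nat.Prime p}.indicator 1 : ℕ → ℂ) k) =O[atTop]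
      fun t ↦ t * Real.log t ^ (-α - 1) := by
  refine Asymptotics.IsBigO.of_bound (C * (Real.log 4 + 1)) ?_
  filter_upwards [eventually_gt_atTop B, eventually_ge_atTop 2,
    Chebyshev.eventually_primeCounting_le one_pos] with x hxB hx2 hpi
  have hx0 : 0 < x := by linarith
  have hlog : 0 < Real.log x := Real.log_pos (by linarith)
  have hsum : ∑ k ∈ Finset.Icc 1 ⌊x⌋₊,
      (S.indicator 1 - (d : ℂ) • {p | Nat.Prime p}.indicator 1 : ℕ → ℂ) k =
      ((primeCount S x - d * primeCount {p | Nat.Prime p} x : ℝ) : ℂ) := by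
    push_cast
    rw [primeCount_eq_sum_indicator (fun h ↦ Nat.not_prime_zero (hS 0 h)) hx0.le,
      primeCount_eq_sum_indicator (S := {p | Nat.Prime p}) Nat.not_prime_zero hx0.le, Finset.mul_sum,
      ← Finset.sum_sub_distrib]
    rfl
  have hpos : 0 < (primeCount {p | Nat.Prime p} x : ℝ) := by
    rw [primeCount_setOf_prime hx0.le, Nat.cast_pos, Nat.pos_iff_ne_zero, Ne,
      Nat.primeCounting_eq_zero_iff, not_le]
    exact Nat.lt_of_succ_le (Nat.le_floor hx2)
  have hfac : (primeCount S x - d * primeCount {p | Nat.Prime p} x : ℝ) =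
      (primeCount S x / primeCount {p | Nat.Prime p} x - d) *
        primeCount {p | Nat.Prime p} x := by
    field_simp
  rw [hsum, Complex.norm_real, Real.norm_eq_abs, hfac, abs_mul, abs_of_pos hpos,
    Real.norm_of_nonneg (by positivity)]
  rw [← primeCount_setOf_prime hx0.le] at hpi
  refine (mul_le_mul (hE x hxB) hpi hpos.le ((abs_nonneg _).trans (hE x hxB))).trans_eq ?_
  rw [Real.rpow_sub hlog, Real.rpow_neg hlog.le, Real.rpow_one]
  field_simp

/-- Let `S` be a set of primes with natural density `d`, and let
`E(x) := π_S(x)/π(x) − d`. If there exist `α > 0`, `C > 0` and `B > 0` with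
`|E(x)| ≤ C/(log x)^α` for all `x > B`, then `S` is weakly regular (with constant `d`)
and has Dirichlet density `d`. -/
theorem weaklyRegular_of_log_power_error
    (S : Set ℕ) (hS : ∀ p ∈ S, Nat.Prime p) (d : ℝ)
    (hd : Tendsto
      (fun x : ℝ => (primeCount S x : ℝ) / (primeCount {p | Nat.Prime p} x : ℝ))
      atTop (𝓝 d))
    (α C B : ℝ) (hα : 0 < α) (hC : 0 < C) (hB : 0 < B)
    (hE : ∀ x : ℝ, B < x →
      |(primeCount S x : ℝ) / (primeCount {p | Nat.Prime p} x : ℝ) - d| ≤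
        C / Real.log x ^ α) :
    (∃ g : ℂ → ℂ, DifferentiableOn ℂ g {z : ℂ | 1 < z.re} ∧
      ContinuousOn g {z : ℂ | 1 ≤ z.re} ∧
      ∀ z : ℂ, 1 < z.re →
        (∑' p : S, ((p : ℕ) : ℂ) ^ (-z)) = (d : ℂ) * Complex.log (1 / (z - 1)) + g z) ∧
    Tendsto (fun z : ℝ => (∑' p : S, ((p : ℕ) : ℝ) ^ (-z)) / Real.log (1 / (z - 1)))
      (𝓝[>] 1) (𝓝 d) := by
  obtain ⟨h, hhc, hh⟩ := exists_continuousOn_tsum_primes_eq_log_add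
  have hbdd : ∀ n, ‖(S.indicator 1 - (d : ℂ) • {p | Nat.Prime p}.indicator 1 : ℕ → ℂ) n‖ ≤
      1 + |d| * 1 := fun n ↦ by
    refine (norm_sub_le _ _).trans (add_le_add (norm_indicator_one_le S n) ?_)
    rw [Pi.smul_apply, norm_smul, Complex.norm_real, Real.norm_eq_abs]
    exact mul_le_mul_of_nonneg_left (norm_indicator_one_le _ n) (abs_nonneg d)
  obtain ⟨k, hkc, hk⟩ := exists_continuousOn_eq_LSeries_of_isBigO hbdd hα
    (isBigO_sum_indicator_sub_of_log_power_error hS hE)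
  have hgc : ContinuousOn (fun z ↦ k z + d * h z) {z : ℂ | 1 ≤ z.re} :=
    hkc.add (continuousOn_const.mul hhc)
  have heq : ∀ z : ℂ, 1 < z.re → LSeries (S.indicator 1) z =
      (d : ℂ) * Complex.log (1 / (z - 1)) + (k z + d * h z) := fun z hz ↦ by
    have hsummable (T : Set ℕ) : LSeriesSummable (T.indicator 1) z :=
      LSeriesSummable_of_bounded_of_one_lt_re (fun n _ ↦ norm_indicator_one_le T n) hz
    have hkz := hk z hz
    rw [LSeries_sub (hsummable S) ((hsummable _).smul _), LSeries_smul, hh z hz] at hkz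
    linear_combination hkz
  refine ⟨⟨fun z ↦ k z + d * h z, ?_, hgc, fun z hz ↦ ?_⟩, ?_⟩
  · have hlog : DifferentiableOn ℂ (fun z ↦ Complex.log (1 / (z - 1))) {z : ℂ | 1 < z.re} := by
      have hslit : ∀ z ∈ {z : ℂ | 1 < z.re}, z - 1 ∈ Complex.slitPlane :=
        fun z hz ↦ Or.inl (by simpa using hz)
      refine ((differentiableOn_id.sub_const 1).clog hslit).neg.congr fun z hz ↦ ?_
      rw [one_div, Complex.log_inv _ (Complex.slitPlane_arg_ne_pi (hslit z hz))]
      rfl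
    refine ((differentiableOn_LSeries_indicator S).sub (hlog.const_mul (d : ℂ))).congr
      fun z hz ↦ ?_
    simp [heq z hz]
  · rw [tsum_subtype_cpow_neg_eq_LSeries hS, heq z hz]
  · have hre : ∀ z : ℝ, 1 < z → (∑' p : S, ((p : ℕ) : ℝ) ^ (-z)) =
        d * Real.log (1 / (z - 1)) + (k z + d * h z).re := fun z hz ↦ by
      have hc : ((∑' p : S, ((p : ℕ) : ℝ) ^ (-z) : ℝ) : ℂ) =
          (d : ℂ) * Complex.log (1 / (z - 1)) + (k z + d * h z) := by
        rw [← heq z (by simpa using hz), ← tsum_subtype_cpow_neg_eq_LSeries hS, Complex.ofReal_tsum]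
        refine tsum_congr fun p ↦ ?_
        rw [Complex.ofReal_cpow (Nat.cast_nonneg _)]
        push_cast
        rfl
      have hl : Complex.log (1 / (z - 1)) = (Real.log (1 / (z - 1)) : ℂ) := by
        rw [Complex.ofReal_log (one_div_nonneg.2 (by linarith))]
        push_cast
        rfl
      rw [hl] at hc
      have := congrArg Complex.re hc
      rwa [Complex.add_re, Complex.re_ofReal_mul, Complex.ofReal_re, Complex.ofReal_re] at this
    have hlog : Tendsto (fun z : ℝ ↦ Real.log (1 / (z - 1))) (𝓝[>] 1) atTop := by
      simp_rw [one_div]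
      refine Real.tendsto_log_atTop.comp (tendsto_inv_nhdsGT_zero.comp ?_)
      refine tendsto_nhdsWithin_iff.2 ⟨?_, ?_⟩
      · exact ((continuous_id.sub continuous_const).tendsto' (1 : ℝ) 0 (sub_self 1)).mono_left
          nhdsWithin_le_nhds
      · filter_upwards [self_mem_nhdsWithin] with z (hz : 1 < z) using sub_pos.2 hz
    have hg : Tendsto (fun z : ℝ ↦ (k z + d * h z).re) (𝓝[>] 1) (𝓝 (k 1 + d * h 1).re) := by
      refine (Complex.continuous_re.tendsto _).comp ((hgc 1 (by simp)).tendsto.comp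
        (f := fun z : ℝ ↦ (z : ℂ)) (tendsto_nhdsWithin_iff.2 ⟨?_, ?_⟩))
      · exact (Complex.continuous_ofReal.tendsto' 1 1 Complex.ofReal_one).mono_left
          nhdsWithin_le_nhds
      · filter_upwards [self_mem_nhdsWithin] with z hz
        simpa using le_of_lt hz
    have hlim := (hg.div_atTop hlog).const_add d
    rw [add_zero] at hlim
    refine hlim.congr' ?_
    filter_upwards [self_mem_nhdsWithin, hlog.eventually_gt_atTop 0] with z hz hz0
    rw [hre z hz, add_div, mul_div_assoc, div_self hz0.ne', mul_one]
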